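/- Let q be a prime power and let ℓ, m be integers with 2 ≤ ℓ ≤ m. Then for every α = (α_1,…,α_ℓ) ∈ I(ℓ,m), one has Σ_{β ∈ ∇(α)} q^{β_1 + ⋯ + β_ℓ} < (q/(q−1))^ℓ · q^{α_1 + ⋯ + α_ℓ}. -/

import Mathlib

/-- The index set `I(ℓ,m)`: strictly increasing `ℓ`-tuples with entries in `{1,…,m}`. -/
def Idx (ℓ m : ℕ) : Set (Fin ℓ → ℕ) :=
  {α | StrictMono α ∧ ∀ i, 1 ≤ α i ∧ α i ≤ m}

/-- `∇(α) = {β ∈ I(ℓ,m) : β ≤ α}`. -/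
def Nabla (ℓ m : ℕ) (α : Fin ℓ → ℕ) : Set (Fin ℓ → ℕ) :=
  {β | β ∈ Idx ℓ m ∧ ∀ i, β i ≤ α i}

lemma Nabla.finite (ℓ m : ℕ) (α : Fin ℓ → ℕ) : (Nabla ℓ m α).Finite := by
  apply (Set.finite_Icc (fun _ : Fin ℓ => 0) (fun _ => m)).subset
  rintro β ⟨hβ, -⟩
  exact Set.mem_Icc.mpr ⟨fun i => Nat.zero_le _, fun i => (hβ.2 i).2⟩

/-- For `x > 1`, a partial geometric sum is less than its last term times `x / (x - 1)`. -/
lemma geom_sum_range_succ_lt {x : ℝ} (hx : 1 < x) (n : ℕ) :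
    ∑ j ∈ Finset.range (n + 1), x ^ j < x / (x - 1) * x ^ n := by
  have h : 0 < x - 1 := sub_pos.mpr hx
  rw [geom_sum_eq hx.ne', div_mul_eq_mul_div, ← pow_succ']
  gcongr
  linarith

/-- The sum of `x ^ (∑ i, β i)` over any finite set of tuples bounded by `α` is less than
`(x / (x - 1)) ^ ℓ * x ^ (∑ i, α i)`. -/
lemma sum_pow_sum_lt_of_forall_le {ℓ : ℕ} (hℓ : 0 < ℓ) {x : ℝ} (hx : 1 < x) (α : Fin ℓ → ℕ)
    (s : Finset (Fin ℓ → ℕ)) (hs : ∀ β ∈ s, ∀ i, β i ≤ α i) :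
    ∑ β ∈ s, x ^ (∑ i, β i) < (x / (x - 1)) ^ ℓ * x ^ (∑ i, α i) := by
  have hx0 : 0 < x := one_pos.trans hx
  have hsub : s ⊆ Fintype.piFinset fun i => Finset.range (α i + 1) := fun β hβ =>
    Fintype.mem_piFinset.mpr fun i => Finset.mem_range_succ_iff.mpr (hs β hβ i)
  calc ∑ β ∈ s, x ^ (∑ i, β i)
      ≤ ∑ β ∈ Fintype.piFinset fun i => Finset.range (α i + 1), x ^ (∑ i, β i) :=
        Finset.sum_le_sum_of_subset_of_nonneg hsub fun _ _ _ => by positivity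
    _ = ∏ i, ∑ j ∈ Finset.range (α i + 1), x ^ j := by
        simp_rw [Finset.prod_univ_sum, Finset.prod_pow_eq_pow_sum]
    _ < ∏ i, (x / (x - 1) * x ^ α i) :=
        Finset.prod_lt_prod_of_nonempty
          (fun _ _ => Finset.sum_pos (fun _ _ => by positivity) Finset.nonempty_range_add_one)
          (fun i _ => geom_sum_range_succ_lt hx (α i)) ⟨⟨0, hℓ⟩, Finset.mem_univ _⟩
    _ = (x / (x - 1)) ^ ℓ * x ^ (∑ i, α i) := by
        rw [Finset.prod_mul_distrib, Finset.prod_pow_eq_pow_sum, Fin.prod_const]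

/-- Lemma 3.2: for `q` a prime power, `ℓ ≥ 2`, and `α ∈ I(ℓ,m)`,
`Σ_{β ∈ ∇(α)} q^{β_1 + ⋯ + β_ℓ} < (q/(q−1))^ℓ · q^{α_1 + ⋯ + α_ℓ}`. -/
theorem stmt0 (q ℓ m : ℕ) (hq : IsPrimePow q) (hℓ : 2 ≤ ℓ) (hm : ℓ ≤ m)
    (α : Fin ℓ → ℕ) (hα : α ∈ Idx ℓ m) :
    ∑ β ∈ (Nabla.finite ℓ m α).toFinset, (q : ℝ) ^ (∑ i, β i)
      < ((q : ℝ) / ((q : ℝ) - 1)) ^ ℓ * (q : ℝ) ^ (∑ i, α i) := by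
  refine sum_pow_sum_lt_of_forall_le (by omega) (by exact_mod_cast hq.one_lt) α _ fun β hβ => ?_
  exact ((Set.Finite.mem_toFinset _).mp hβ).2
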